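/- arXiv:2305.19087 — 6 statements merged into one kernel-verified Lean document; each statement's English description precedes it below -/
import Mathlib

section
/- Let A ∈ ℝ^{n×n} be symmetric with a simple eigenvalue ρ > 0 such that |λ| < ρ for every other eigenvalue λ, and let v be a unit eigenvector for ρ. Let H ∈ {0,1}^{n×k} be a partition indicator matrix with nonempty classes and P = H (Hᵀ H)^{-1} Hᵀ. Then lim_{t→∞} ρ^{-t} ‖A^t H − P A^t H‖₁ = ‖(I − P) v vᵀ H‖₁, where ‖M‖₁ denotes the sum of absolute values of the entries of M. -/
open Matrix Filter

/-- The entrywise ℓ1 norm of a matrix: the sum of the absolute values of its entries. -/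
noncomputable def l1norm {n k : ℕ} (M : Matrix (Fin n) (Fin k) ℝ) : ℝ :=
  ∑ i, ∑ j, |M i j|

/-- A vector in the one-dimensional eigenspace spanned by the unit vector `v` is recovered from its
inner product with `v`. -/
lemma eq_dotProduct_smul_of_finrank_eigenspace_eq_one {n : ℕ} {A : Matrix (Fin n) (Fin n) ℝ}
    {ρ : ℝ} (hsimple : Module.finrank ℝ (Module.End.eigenspace (Matrix.toLin' A) ρ) = 1)
    {v : Fin n → ℝ} (hv : A *ᵥ v = ρ • v) (hvunit : v ⬝ᵥ v = 1)
    {u : Fin n → ℝ} (hu : A *ᵥ u = ρ • u) : (v ⬝ᵥ u) • v = u := by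
  have hvmem : v ∈ Module.End.eigenspace (Matrix.toLin' A) ρ := by
    simpa [Module.End.mem_eigenspace_iff] using hv
  have humem : u ∈ Module.End.eigenspace (Matrix.toLin' A) ρ := by
    simpa [Module.End.mem_eigenspace_iff] using hu
  have hv0 : (⟨v, hvmem⟩ : Module.End.eigenspace (Matrix.toLin' A) ρ) ≠ 0 := by
    intro h
    have hz : v = 0 := congrArg Subtype.val h
    simp [hz] at hvunit
  obtain ⟨c, hc⟩ := (finrank_eq_one_iff_of_nonzero' _ hv0).1 hsimple ⟨u, humem⟩
  have hcu : c • v = u := congrArg Subtype.val hc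
  rw [← hcu, dotProduct_smul, hvunit, smul_eq_mul, mul_one]

/-- Eigenvectors of a symmetric matrix for distinct eigenvalues are orthogonal. -/
lemma Matrix.IsSymm.dotProduct_eq_zero_of_eigenvalue_ne {n : ℕ} {A : Matrix (Fin n) (Fin n) ℝ}
    (hA : A.IsSymm) {ρ μ : ℝ} (hne : μ ≠ ρ) {v u : Fin n → ℝ} (hv : A *ᵥ v = ρ • v)
    (hu : A *ᵥ u = μ • u) : v ⬝ᵥ u = 0 := by
  have h : v ⬝ᵥ (A *ᵥ u) = (A *ᵥ v) ⬝ᵥ u := by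
    rw [dotProduct_mulVec, ← mulVec_transpose, hA.eq]
  rw [hu, hv, dotProduct_smul, smul_dotProduct, smul_eq_mul, smul_eq_mul] at h
  exact (mul_eq_mul_right_iff.1 h).resolve_left hne

lemma pow_mulVec_of_mulVec_eq_smul {n : ℕ} {A : Matrix (Fin n) (Fin n) ℝ} {μ : ℝ}
    {u : Fin n → ℝ} (hu : A *ᵥ u = μ • u) (t : ℕ) : A ^ t *ᵥ u = μ ^ t • u := by
  induction t with
  | zero => simp
  | succ t ih => rw [pow_succ, ← mulVec_mulVec, hu, mulVec_smul, ih, smul_smul, pow_succ']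

/-- Power iteration: the rescaled powers of a symmetric matrix with simple dominant eigenvalue `ρ`
converge pointwise to the orthogonal projection onto the dominant eigenvector. -/
lemma Matrix.IsSymm.tendsto_inv_pow_smul_pow_mulVec {n : ℕ} {A : Matrix (Fin n) (Fin n) ℝ}
    (hA : A.IsSymm) {ρ : ℝ} (hρpos : 0 < ρ)
    (hsimple : Module.finrank ℝ (Module.End.eigenspace (Matrix.toLin' A) ρ) = 1)
    (hdom : ∀ μ ∈ spectrum ℝ A, μ ≠ ρ → |μ| < ρ)
    {v : Fin n → ℝ} (hv : A *ᵥ v = ρ • v) (hvunit : v ⬝ᵥ v = 1) (x : Fin n → ℝ) :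
    Tendsto (fun t : ℕ => (ρ ^ t)⁻¹ • (A ^ t *ᵥ x)) atTop (nhds ((v ⬝ᵥ x) • v)) := by
  have hherm : A.IsHermitian := by rwa [Matrix.IsHermitian, conjTranspose_eq_transpose_of_trivial]
  have heigen (i : Fin n) : Tendsto
      (fun t : ℕ => (ρ ^ t)⁻¹ • (A ^ t *ᵥ (hherm.eigenvectorBasis i).ofLp)) atTop
      (nhds ((v ⬝ᵥ (hherm.eigenvectorBasis i).ofLp) • v)) := by
    have hu : A *ᵥ (hherm.eigenvectorBasis i).ofLp
        = hherm.eigenvalues i • (hherm.eigenvectorBasis i).ofLp := hherm.mulVec_eigenvectorBasis i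
    simp only [pow_mulVec_of_mulVec_eq_smul hu, smul_smul]
    by_cases hi : hherm.eigenvalues i = ρ
    · rw [hi] at hu ⊢
      rw [eq_dotProduct_smul_of_finrank_eigenspace_eq_one hsimple hv hvunit hu]
      simp [inv_mul_cancel₀ (pow_ne_zero _ hρpos.ne')]
    · rw [hA.dotProduct_eq_zero_of_eigenvalue_ne hi hv hu]
      have hlt : |hherm.eigenvalues i / ρ| < 1 := by
        rw [abs_div, abs_of_pos hρpos, div_lt_one hρpos]
        exact hdom _ (hherm.eigenvalues_mem_spectrum_real i) hi
      have hratio : Tendsto (fun t : ℕ => (ρ ^ t)⁻¹ * hherm.eigenvalues i ^ t) atTop (nhds 0) := by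
        simpa only [div_eq_inv_mul, mul_pow, inv_pow] using
          tendsto_pow_atTop_nhds_zero_of_abs_lt_one hlt
      simpa only [zero_smul] using hratio.smul_const (hherm.eigenvectorBasis i).ofLp
  have hx : x = ∑ i, hherm.eigenvectorBasis.repr (WithLp.toLp 2 x) i
      • (hherm.eigenvectorBasis i).ofLp := by
    have h := congrArg WithLp.ofLp (hherm.eigenvectorBasis.sum_repr (WithLp.toLp 2 x))
    simpa using h.symm
  rw [hx]
  simp only [mulVec_sum, mulVec_smul, dotProduct_sum, dotProduct_smul, Finset.smul_sum,
    Finset.sum_smul]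
  refine tendsto_finsetSum _ fun i _ => ?_
  simpa only [smul_comm _ (hherm.eigenvectorBasis.repr (WithLp.toLp 2 x) i), smul_assoc]
    using (heigen i).const_smul (hherm.eigenvectorBasis.repr (WithLp.toLp 2 x) i)

lemma l1norm_smul {n k : ℕ} (c : ℝ) (M : Matrix (Fin n) (Fin k) ℝ) :
    l1norm (c • M) = |c| * l1norm M := by
  simp [l1norm, abs_mul, Finset.mul_sum]

lemma continuous_l1norm {n k : ℕ} :
    Continuous (l1norm : Matrix (Fin n) (Fin k) ℝ → ℝ) := by
  unfold l1norm
  fun_prop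

/-- Let `A` be a real symmetric matrix with a simple, strictly dominant
eigenvalue `ρ > 0` and unit eigenvector `v`, and let `H` be the indicator matrix of a
partition into nonempty classes with `P = H (Hᵀ H)⁻¹ Hᵀ`. Then the rescaled short-term
costs converge: `ρ⁻ᵗ ‖Aᵗ H − P Aᵗ H‖₁ → ‖(I − P) v vᵀ H‖₁` as `t → ∞`. -/
theorem rescaled_short_term_cost_tendsto {n k : ℕ} (A : Matrix (Fin n) (Fin n) ℝ)
    (hA : A.IsSymm) (ρ : ℝ) (hρpos : 0 < ρ) (hmem : ρ ∈ spectrum ℝ A)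
    (hsimple : Module.finrank ℝ (Module.End.eigenspace (Matrix.toLin' A) ρ) = 1)
    (hdom : ∀ μ ∈ spectrum ℝ A, μ ≠ ρ → |μ| < ρ)
    (v : Fin n → ℝ) (hv : A.mulVec v = ρ • v) (hvunit : ∑ i, v i ^ 2 = 1)
    (f : Fin n → Fin k) (hf : Function.Surjective f)
    (H : Matrix (Fin n) (Fin k) ℝ)
    (hH : H = Matrix.of fun i j => if f i = j then (1 : ℝ) else 0)
    (P : Matrix (Fin n) (Fin n) ℝ) (hP : P = H * (Hᵀ * H)⁻¹ * Hᵀ) :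
    Tendsto (fun t : ℕ => (ρ ^ t)⁻¹ * l1norm (A ^ t * H - P * (A ^ t * H))) atTop
      (nhds (l1norm ((1 - P) * Matrix.vecMulVec v v * H))) := by
  have hvdot : v ⬝ᵥ v = 1 := by simpa [dotProduct, sq] using hvunit
  have hpow : Tendsto (fun t : ℕ => (ρ ^ t)⁻¹ • A ^ t) atTop (nhds (vecMulVec v v)) := by
    refine tendsto_pi_nhds.2 fun i => tendsto_pi_nhds.2 fun j => ?_
    have h := tendsto_pi_nhds.1
      (hA.tendsto_inv_pow_smul_pow_mulVec hρpos hsimple hdom hv hvdot (Pi.single j 1)) i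
    simpa [vecMulVec_apply, mul_comm (v i)] using h
  have hcont : Continuous fun M : Matrix (Fin n) (Fin n) ℝ => l1norm ((1 - P) * M * H) :=
    continuous_l1norm.comp (by fun_prop)
  refine ((hcont.tendsto _).comp hpow).congr fun t => ?_
  rw [Function.comp_apply, Matrix.mul_smul, Matrix.smul_mul, l1norm_smul,
    abs_of_pos (inv_pos.2 (pow_pos hρpos t)), Matrix.mul_assoc, Matrix.sub_mul, Matrix.one_mul]
end

section
/- Let w ∈ ℝ^n, let v ∈ ℝ^n have nonnegative entries, and let H ∈ {0,1}^{n×k} be a partition indicator matrix of a partition C = (C_1,…,C_k) of {1,…,n} into nonempty classes, with P = H (Hᵀ H)^{-1} Hᵀ. Then ‖(I − P) w vᵀ H‖₁ = (Σ_{i=1}^n v_i) · Σ_{i=1}^n | w_i − (1/|C(i)|) Σ_{l ∈ C(i)} w_l |, where C(i) denotes the class containing i and ‖M‖₁ = Σ_{i,j} |M_{i,j}|. -/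
open Matrix Finset

/-- The Gram matrix of a partition indicator matrix is diagonal, with the class sizes on the
diagonal. -/
theorem indicator_transpose_mul_self {n k : ℕ} (f : Fin n → Fin k) :
    (Matrix.of fun i j => if f i = j then (1 : ℝ) else 0)ᵀ *
        (Matrix.of fun i j => if f i = j then (1 : ℝ) else 0) =
      Matrix.diagonal fun j => ((Finset.univ.filter fun l => f l = j).card : ℝ) := by
  ext a b
  by_cases hab : a = b
  · subst hab
    simp [Matrix.mul_apply, ← ite_and]
  · rw [Matrix.diagonal_apply_ne _ hab, Matrix.mul_apply]
    refine Finset.sum_eq_zero fun i _ => ?_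
    by_cases h : f i = a <;> simp [h, hab]

/-- The projection onto the span of the class indicators replaces each entry of a vector by its
class mean. -/
theorem indicator_proj_mulVec {n k : ℕ} (f : Fin n → Fin k) (hf : Function.Surjective f)
    (H : Matrix (Fin n) (Fin k) ℝ)
    (hH : H = Matrix.of fun i j => if f i = j then (1 : ℝ) else 0) (w : Fin n → ℝ) (i : Fin n) :
    ((H * (Hᵀ * H)⁻¹ * Hᵀ) *ᵥ w) i =
      (∑ l ∈ Finset.univ.filter fun l => f l = f i, w l) /
        ((Finset.univ.filter fun l => f l = f i).card : ℝ) := by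
  have hcard : ∀ j, ((Finset.univ.filter fun l => f l = j).card : ℝ) ≠ 0 := fun j => by
    obtain ⟨l, hl⟩ := hf j
    exact Nat.cast_ne_zero.mpr (Finset.card_ne_zero_of_mem (by simpa using hl))
  have hinv : (Hᵀ * H)⁻¹ =
      Matrix.diagonal fun j => ((Finset.univ.filter fun l => f l = j).card : ℝ)⁻¹ := by
    rw [hH, indicator_transpose_mul_self]
    refine Matrix.inv_eq_right_inv ?_
    rw [Matrix.diagonal_mul_diagonal, ← Matrix.diagonal_one]
    congr 1
    ext j
    exact mul_inv_cancel₀ (hcard j)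
  rw [hinv, ← Matrix.mulVec_mulVec, ← Matrix.mulVec_mulVec, hH]
  simp [Matrix.mulVec, dotProduct, Matrix.diagonal_apply, Finset.sum_filter, div_eq_inv_mul]

/-- Let `w ∈ ℝⁿ`, let `v ∈ ℝⁿ` have nonnegative entries, and let `H` be the
indicator matrix of a partition of `{1,…,n}` into `k` nonempty classes (given by a surjective
`f : Fin n → Fin k`), with `P = H (Hᵀ H)⁻¹ Hᵀ`. Then
`‖(I − P) w vᵀ H‖₁ = (∑ᵢ vᵢ) · ∑ᵢ |wᵢ − (mean of w over the class of i)|`. -/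
theorem l1norm_proj_vecMulVec {n k : ℕ} (w v : Fin n → ℝ) (hv : ∀ i, 0 ≤ v i)
    (f : Fin n → Fin k) (hf : Function.Surjective f)
    (H : Matrix (Fin n) (Fin k) ℝ)
    (hH : H = Matrix.of fun i j => if f i = j then (1 : ℝ) else 0)
    (P : Matrix (Fin n) (Fin n) ℝ) (hP : P = H * (Hᵀ * H)⁻¹ * Hᵀ) :
    l1norm ((1 - P) * Matrix.vecMulVec w v * H) =
      (∑ i, v i) *
        ∑ i, |w i - (∑ l ∈ Finset.univ.filter fun l => f l = f i, w l) /
          ((Finset.univ.filter fun l => f l = f i).card : ℝ)| := by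
  have hvH : ∀ j, (v ᵥ* H) j = ∑ i, if f i = j then v i else 0 := fun j => by
    simp [hH, Matrix.vecMul, dotProduct]
  have hnonneg : ∀ j, 0 ≤ (v ᵥ* H) j := fun j => by
    rw [hvH]
    exact Finset.sum_nonneg fun i _ => by split_ifs <;> simp [hv i]
  have hsum : ∑ j, (v ᵥ* H) j = ∑ i, v i := by
    simp_rw [hvH]
    rw [Finset.sum_comm]
    simp
  have hproj : ∀ i, ((1 - P) *ᵥ w) i =
      w i - (∑ l ∈ Finset.univ.filter fun l => f l = f i, w l) /
        ((Finset.univ.filter fun l => f l = f i).card : ℝ) := fun i => by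
    rw [Matrix.sub_mulVec, Matrix.one_mulVec, Pi.sub_apply, hP,
      indicator_proj_mulVec f hf H hH]
  rw [Matrix.mul_vecMulVec, Matrix.vecMulVec_mul, l1norm]
  simp_rw [Matrix.vecMulVec_apply, abs_mul, abs_of_nonneg (hnonneg _), ← Finset.mul_sum, hsum,
    ← Finset.sum_mul, hproj]
  rw [mul_comm]
end

section
/- Let a_1, …, a_m be real numbers with m ≥ 1 and let ā = (1/m) Σ_{i=1}^m a_i be their mean. Then Σ_{i=1}^m (a_i − ā)² ≥ ( (max_i a_i − min_i a_i) / 2 )². -/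
open Finset

/-- The square of half the difference of two terms of a finite family is at most the sum of the
squared deviations of the family from any point `c`. -/
lemma half_sub_sq_le_sum_sq_dev {ι : Type*} [Fintype ι] (a : ι → ℝ) (c : ℝ) (i j : ι) :
    ((a i - a j) / 2) ^ 2 ≤ ∑ k, (a k - c) ^ 2 := by
  have h (l : ι) : (a l - c) ^ 2 ≤ ∑ k, (a k - c) ^ 2 :=
    Finset.single_le_sum (f := fun k => (a k - c) ^ 2) (fun k _ => sq_nonneg _)
      (Finset.mem_univ l)
  nlinarith [h i, h j, sq_nonneg ((a i - c) + (a j - c))]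

/-- For real numbers `a 1, …, a m` with `m ≥ 1` and mean
`ā = (1/m) ∑ᵢ aᵢ`, the sum of squared deviations from the mean is at least the square of
half the range: `∑ᵢ (aᵢ − ā)² ≥ ((maxᵢ aᵢ − minᵢ aᵢ)/2)²`. -/
theorem sum_sq_dev_ge_half_range_sq {m : ℕ} (hm : 0 < m) (a : Fin m → ℝ) :
    ((Finset.univ.sup' (Finset.univ_nonempty_iff.mpr (Fin.pos_iff_nonempty.mp hm)) a -
        Finset.univ.inf' (Finset.univ_nonempty_iff.mpr (Fin.pos_iff_nonempty.mp hm)) a) / 2) ^ 2 ≤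
      ∑ i, (a i - (∑ i, a i) / (m : ℝ)) ^ 2 := by
  have hne := Finset.univ_nonempty_iff.mpr (Fin.pos_iff_nonempty.mp hm)
  obtain ⟨i, -, hi⟩ := Finset.exists_mem_eq_sup' hne a
  obtain ⟨j, -, hj⟩ := Finset.exists_mem_eq_inf' hne a
  rw [hi, hj]
  exact half_sub_sq_le_sum_sq_dev a _ i j
end

section
/- Let (x_1, y_1), …, (x_n, y_n) be points in the plane with all coordinates nonnegative, and let D = 1 + Σ_{i=1}^n (x_i² + y_i²). Construct the weighted graph on vertex set V = {a, b, m_1, …, m_n} with symmetric weight matrix A given by: A_{a,a} = 3D, A_{b,b} = 6D, A_{m_i, a} = A_{a, m_i} = x_i, A_{m_i, b} = A_{b, m_i} = y_i, and all other entries 0. Let S' = (S'_1, …, S'_k) be any partition of {1,…,n} into k nonempty clusters, and let S = (S_1, …, S_k, {a}, {b}) be the partition of V with m_i ∈ S_j iff i ∈ S'_j. Then the short-term cost Γ_EP(A, S) = Σ_i Σ_j Σ_{v ∈ S_i} ( W({v}, S_j) − W(S_i, S_j)/|S_i| )² equals the k-means cost of S', namely Σ_{j=1}^k Σ_{i ∈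 S'_j} ( (x_i − μ_x(S'_j))² + (y_i − μ_y(S'_j))² ), where μ_x(S'_j) and μ_y(S'_j) are the means of the x- and y-coordinates over S'_j. -/
open Matrix Finset

/-- The vertex set `{a, b, m_1, …, m_n}`: `Sum.inl false` is the apex `a`,
`Sum.inl true` is the apex `b`, and `Sum.inr i` is the point vertex `m_i`. -/
abbrev Vtx (n : ℕ) := Bool ⊕ Fin n

/-- The weight matrix of the reduction graph: self-loops of weight `3D` at `a` and `6D`
at `b`, an edge of weight `x i` between `m_i` and `a`, an edge of weight `y i` between
`m_i` and `b`, and no other edges. -/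
noncomputable def apexA {n : ℕ} (x y : Fin n → ℝ) (D : ℝ) : Matrix (Vtx n) (Vtx n) ℝ :=
  Matrix.of fun u w =>
    match u, w with
    | Sum.inl false, Sum.inl false => 3 * D
    | Sum.inl true, Sum.inl true => 6 * D
    | Sum.inl false, Sum.inr i => x i
    | Sum.inr i, Sum.inl false => x i
    | Sum.inl true, Sum.inr i => y i
    | Sum.inr i, Sum.inl true => y i
    | _, _ => 0

/-- `W(X, Y)`: the sum of the weights of all edges between `X` and `Y`. -/
def Wgt {V : Type*} [Fintype V] (A : Matrix V V ℝ) (X Y : Finset V) : ℝ :=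
  ∑ u ∈ X, ∑ w ∈ Y, A u w

/-- The short-term cost `Γ_EP(A, C)` of a partition `C` in the squared ℓ2 norm:
`∑ᵢ ∑ⱼ ∑_{v ∈ Cᵢ} (W({v}, Cⱼ) − W(Cᵢ, Cⱼ)/|Cᵢ|)²`. -/
noncomputable def shortTermCost {V : Type*} [Fintype V] [DecidableEq V] {r : ℕ}
    (A : Matrix V V ℝ) (C : Fin r → Finset V) : ℝ :=
  ∑ i, ∑ j, ∑ v ∈ C i, (Wgt A {v} (C j) - Wgt A (C i) (C j) / ((C i).card : ℝ)) ^ 2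

/-- The k-means cost of a partition `S` of planar points `(x i, y i)`: the sum over
clusters of the squared Euclidean distances of each point to its cluster centroid. -/
noncomputable def kmeansCost {n k : ℕ} (x y : Fin n → ℝ) (S : Fin k → Finset (Fin n)) : ℝ :=
  ∑ j, ∑ i ∈ S j,
    ((x i - (∑ l ∈ S j, x l) / ((S j).card : ℝ)) ^ 2 +
     (y i - (∑ l ∈ S j, y l) / ((S j).card : ℝ)) ^ 2)

/-- The partition `S = (S_1, …, S_k, {a}, {b})` of the vertex set `Vtx n` obtained from a
partition `S'` of the points by adding the singleton classes `{a}` and `{b}`. -/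
def extPartition {n k : ℕ} (S' : Fin k → Finset (Fin n)) : Fin (k + 2) → Finset (Vtx n) :=
  fun j =>
    if h : (j : ℕ) < k then (S' ⟨j, h⟩).image Sum.inr
    else if (j : ℕ) = k then {Sum.inl false} else {Sum.inl true}

theorem extPartition_castSucc_castSucc {n k : ℕ} (S' : Fin k → Finset (Fin n)) (j : Fin k) :
    extPartition S' j.castSucc.castSucc = (S' j).image Sum.inr := by
  simp [extPartition]

theorem extPartition_castSucc_last {n k : ℕ} (S' : Fin k → Finset (Fin n)) :
    extPartition S' (Fin.last k).castSucc = {Sum.inl false} := by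
  simp [extPartition]

theorem extPartition_last {n k : ℕ} (S' : Fin k → Finset (Fin n)) :
    extPartition S' (Fin.last (k + 1)) = {Sum.inl true} := by
  simp [extPartition]

/-- For nonnegative planar points `(x i, y i)`, `D = 1 + ∑ᵢ (xᵢ² + yᵢ²)`,
and any partition `S'` of the points into `k` nonempty clusters, the short-term cost of the
extended partition `(S'_1, …, S'_k, {a}, {b})` of the reduction graph equals the k-means
cost of `S'`. -/
theorem shortTermCost_extPartition_eq_kmeansCost {n k : ℕ}
    (x y : Fin n → ℝ) (hx : ∀ i, 0 ≤ x i) (hy : ∀ i, 0 ≤ y i)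
    (D : ℝ) (hD : D = 1 + ∑ i, (x i ^ 2 + y i ^ 2))
    (S' : Fin k → Finset (Fin n))
    (hne : ∀ j, (S' j).Nonempty)
    (hdisj : ∀ j j', j ≠ j' → Disjoint (S' j) (S' j'))
    (hcover : ∀ i : Fin n, ∃ j, i ∈ S' j) :
    shortTermCost (apexA x y D) (extPartition S') = kmeansCost x y S' := by
  have card_image_inr (T : Finset (Fin n)) :
      (T.image (Sum.inr : Fin n → Vtx n)).card = T.card :=
    card_image_of_injective T Sum.inr_injective
  simp [shortTermCost, kmeansCost, Fin.sum_univ_castSucc, extPartition_castSucc_castSucc,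
    extPartition_castSucc_last, extPartition_last, Wgt, apexA, card_image_inr,
    sum_add_distrib]
end

section
/- Let (x_1, y_1), …, (x_n, y_n) be points in the plane with all coordinates nonnegative, D = 1 + Σ_{i=1}^n (x_i² + y_i²), and let A be the weight matrix of the graph on V = {a, b, m_1, …, m_n} with A_{a,a} = 3D, A_{b,b} = 6D, A_{m_i,a} = A_{a,m_i} = x_i, A_{m_i,b} = A_{b,m_i} = y_i, and all other entries 0. Let C = (C_1, …, C_r) be any partition of V such that some class C_i strictly contains {a} (i.e., contains a together with at least one other vertex) or strictly contains {b}. Then the short-term cost satisfies Γ_EP(A, C) = Σ_i Σ_j Σ_{v ∈ C_i} ( W({v}, C_j) − W(C_i, C_j)/|C_i| )² ≥ D. -/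
open Matrix Finset

/-- Two distinct vertices of one class already contribute half the squared difference of their
weights into that class. -/
lemma half_sq_sub_le_shortTermCost {V : Type*} [Fintype V] [DecidableEq V] {r : ℕ}
    (A : Matrix V V ℝ) (C : Fin r → Finset V) {i : Fin r} {u v : V}
    (hu : u ∈ C i) (hv : v ∈ C i) (huv : u ≠ v) :
    (Wgt A {u} (C i) - Wgt A {v} (C i)) ^ 2 / 2 ≤ shortTermCost A C := by
  set c := Wgt A (C i) (C i) / ((C i).card : ℝ)
  calc (Wgt A {u} (C i) - Wgt A {v} (C i)) ^ 2 / 2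
      ≤ (Wgt A {u} (C i) - c) ^ 2 + (Wgt A {v} (C i) - c) ^ 2 := by
        nlinarith [sq_nonneg (Wgt A {u} (C i) + Wgt A {v} (C i) - 2 * c)]
    _ = ∑ w ∈ {u, v}, (Wgt A {w} (C i) - c) ^ 2 := by rw [sum_pair huv]
    _ ≤ ∑ w ∈ C i, (Wgt A {w} (C i) - c) ^ 2 :=
        sum_le_sum_of_subset_of_nonneg (by simp [insert_subset_iff, hu, hv])
          fun _ _ _ => sq_nonneg _
    _ ≤ ∑ j, ∑ w ∈ C i, (Wgt A {w} (C j) - Wgt A (C i) (C j) / ((C i).card : ℝ)) ^ 2 :=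
        single_le_sum
          (f := fun j => ∑ w ∈ C i, (Wgt A {w} (C j) - Wgt A (C i) (C j) / ((C i).card : ℝ)) ^ 2)
          (fun _ _ => sum_nonneg fun _ _ => sq_nonneg _) (mem_univ i)
    _ ≤ shortTermCost A C :=
        single_le_sum
          (f := fun k => ∑ j, ∑ w ∈ C k,
            (Wgt A {w} (C j) - Wgt A (C k) (C j) / ((C k).card : ℝ)) ^ 2)
          (fun _ _ => sum_nonneg fun _ _ => sum_nonneg fun _ _ => sq_nonneg _) (mem_univ i)

lemma apexA_nonneg {n : ℕ} {x y : Fin n → ℝ} (hx : ∀ i, 0 ≤ x i) (hy : ∀ i, 0 ≤ y i)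
    {D : ℝ} (hD : 0 ≤ D) (u w : Vtx n) : 0 ≤ apexA x y D u w := by
  rcases u with (_ | _) | i <;> rcases w with (_ | _) | j <;> simp [apexA, hx, hy, hD]

lemma apexA_self_le_Wgt {n : ℕ} {x y : Fin n → ℝ} (hx : ∀ i, 0 ≤ x i) (hy : ∀ i, 0 ≤ y i)
    {D : ℝ} (hD : 0 ≤ D) {P : Finset (Vtx n)} {u : Vtx n} (hu : u ∈ P) :
    apexA x y D u u ≤ Wgt (apexA x y D) {u} P := by
  rw [Wgt, sum_singleton]
  exact single_le_sum (fun w _ => apexA_nonneg hx hy hD u w) hu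

lemma Wgt_inr_le {n : ℕ} {x y : Fin n → ℝ} (hx : ∀ i, 0 ≤ x i) (hy : ∀ i, 0 ≤ y i)
    {D : ℝ} (hD : 0 ≤ D) (P : Finset (Vtx n)) (i : Fin n) :
    Wgt (apexA x y D) {Sum.inr i} P ≤ x i + y i := by
  rw [Wgt, sum_singleton]
  calc ∑ w ∈ P, apexA x y D (Sum.inr i) w ≤ ∑ w, apexA x y D (Sum.inr i) w :=
        sum_le_sum_of_subset_of_nonneg (subset_univ P) fun w _ _ => apexA_nonneg hx hy hD _ w
    _ = x i + y i := by simp [apexA, Fintype.sum_sum_type, add_comm]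

/-- For nonnegative planar points `(x i, y i)` and
`D = 1 + ∑ᵢ (xᵢ² + yᵢ²)`, any partition `C` of the vertex set of the reduction graph into
nonempty classes in which some class strictly contains `{a}` or strictly contains `{b}`
has short-term cost at least `D`. -/
theorem shortTermCost_ge_of_apex_not_singleton {n r : ℕ}
    (x y : Fin n → ℝ) (hx : ∀ i, 0 ≤ x i) (hy : ∀ i, 0 ≤ y i)
    (D : ℝ) (hD : D = 1 + ∑ i, (x i ^ 2 + y i ^ 2))
    (C : Fin r → Finset (Vtx n))
    (hne : ∀ j, (C j).Nonempty)
    (hdisj : ∀ j j', j ≠ j' → Disjoint (C j) (C j'))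
    (hcover : ∀ v : Vtx n, ∃ j, v ∈ C j)
    (hbad : ∃ i, (Sum.inl false ∈ C i ∧ 2 ≤ (C i).card) ∨
                 (Sum.inl true ∈ C i ∧ 2 ≤ (C i).card)) :
    D ≤ shortTermCost (apexA x y D) C := by
  have hD1 : 1 ≤ D := by
    rw [hD]
    linarith [sum_nonneg fun i (_ : i ∈ univ) => add_nonneg (sq_nonneg (x i)) (sq_nonneg (y i))]
  have hD0 : 0 ≤ D := by linarith
  obtain ⟨i, hi⟩ := hbad
  have hcard : 2 ≤ (C i).card := hi.elim And.right And.right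
  suffices h : ∃ u ∈ C i, ∃ v ∈ C i, u ≠ v ∧
      Wgt (apexA x y D) {v} (C i) + 2 * D ≤ Wgt (apexA x y D) {u} (C i) by
    obtain ⟨u, hu, v, hv, huv, hle⟩ := h
    have hcost := half_sq_sub_le_shortTermCost (apexA x y D) C hu hv huv
    nlinarith
  by_cases hm : ∃ k, Sum.inr k ∈ C i
  · obtain ⟨k, hk⟩ := hm
    have hsmall : Wgt (apexA x y D) {Sum.inr k} (C i) ≤ D := by
      have hk_le : x k ^ 2 + y k ^ 2 ≤ ∑ i, (x i ^ 2 + y i ^ 2) :=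
        single_le_sum (f := fun i => x i ^ 2 + y i ^ 2)
          (fun i _ => add_nonneg (sq_nonneg (x i)) (sq_nonneg (y i))) (mem_univ k)
      nlinarith [Wgt_inr_le hx hy hD0 (C i) k, sq_nonneg (x k - 1), sq_nonneg (y k - 1)]
    rcases hi with ⟨h, -⟩ | ⟨h, -⟩
    all_goals
      refine ⟨_, h, _, hk, by simp, ?_⟩
      have hbig := apexA_self_le_Wgt hx hy hD0 h
      simp only [apexA, of_apply] at hbig hsmall ⊢
      linarith
  · have hsub : C i ⊆ {Sum.inl false, Sum.inl true} := by
      rintro ((_ | _) | k) h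
      · simp
      · simp
      · exact absurd ⟨k, h⟩ hm
    have hCi : C i = {Sum.inl false, Sum.inl true} :=
      eq_of_subset_of_card_le hsub (by simpa using hcard)
    refine ⟨Sum.inl true, by simp [hCi], Sum.inl false, by simp [hCi], by simp, ?_⟩
    simp only [hCi, Wgt, apexA, of_apply, sum_singleton]
    rw [sum_pair (by simp), sum_pair (by simp)]
    linarith
end

section
/- Let (x_1, y_1), …, (x_n, y_n) be points in the plane with all coordinates nonnegative, let k ≥ 1 with n ≥ k, let c ∈ ℝ, let D = 1 + Σ_{i=1}^n (x_i² + y_i²), and let A be the weight matrix on V = {a, b, m_1, …, m_n} with A_{a,a} = 3D, A_{b,b} = 6D, A_{m_i,a} = A_{a,m_i} = x_i, A_{m_i,b} = A_{b,m_i} = y_i, and all other entries 0. Then there exists a partition of {1,…,n} into k nonempty clusters whose k-means cost is at most c if and only if there exists a partition of V into k + 2 nonempty classes whose short-term cost Γ_EP(A, ·) (in the squared ℓ2 norm) is at most c. -/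
open Matrix Finset

/-- The squared deviations from any `μ` sum to at least half the squared gap of two values. -/
lemma sq_sub_div_two_le_sum_sq_sub {V : Type*} [DecidableEq V] (s : Finset V) (f : V → ℝ) (μ : ℝ)
    {u v : V} (hu : u ∈ s) (hv : v ∈ s) (huv : u ≠ v) :
    (f u - f v) ^ 2 / 2 ≤ ∑ w ∈ s, (f w - μ) ^ 2 := by
  have h : ∑ w ∈ ({u, v} : Finset V), (f w - μ) ^ 2 ≤ ∑ w ∈ s, (f w - μ) ^ 2 :=
    sum_le_sum_of_subset_of_nonneg (by grind) fun _ _ _ => sq_nonneg _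
  rw [sum_pair huv] at h
  nlinarith [sq_nonneg (f u - μ + (f v - μ))]

lemma sum_sq_sub_mean_le_sum_sq {V : Type*} (s : Finset V) (f : V → ℝ) :
    ∑ i ∈ s, (f i - (∑ l ∈ s, f l) / (s.card : ℝ)) ^ 2 ≤ ∑ i ∈ s, f i ^ 2 := by
  rcases s.eq_empty_or_nonempty with rfl | hs
  · simp
  have hc : (s.card : ℝ) ≠ 0 := by exact_mod_cast hs.card_pos.ne'
  set μ := (∑ l ∈ s, f l) / (s.card : ℝ) with hμ
  have hsum : ∑ l ∈ s, f l = μ * s.card := (div_eq_iff hc).1 hμ.symm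
  have h : ∑ i ∈ s, (f i - μ) ^ 2 = ∑ i ∈ s, f i ^ 2 - s.card * μ ^ 2 := by
    simp_rw [show ∀ i, (f i - μ) ^ 2 = f i ^ 2 - 2 * μ * f i + μ ^ 2 from fun i => by ring]
    rw [sum_add_distrib, sum_sub_distrib, ← mul_sum, hsum, sum_const, nsmul_eq_mul]
    ring
  rw [h]
  exact sub_le_self _ (mul_nonneg (Nat.cast_nonneg _) (sq_nonneg μ))

/-- The k-means cost of the fibres of a map is at most the sum of the squared norms. -/
lemma kmeansCost_fibers_le {n k : ℕ} (x y : Fin n → ℝ) (f : Fin n → Fin k) :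
    kmeansCost x y (fun j => univ.filter fun i => f i = j) ≤ ∑ i, (x i ^ 2 + y i ^ 2) := by
  rw [← sum_fiberwise univ f]
  refine sum_le_sum fun j _ => ?_
  simp only [sum_add_distrib]
  exact add_le_add (sum_sq_sub_mean_le_sum_sq _ _) (sum_sq_sub_mean_le_sum_sq _ _)

lemma exists_surjective_fin {n k : ℕ} (hk : 1 ≤ k) (hkn : k ≤ n) :
    ∃ f : Fin n → Fin k, Function.Surjective f :=
  ⟨fun i => ⟨min i (k - 1), by omega⟩, fun j => ⟨⟨j, by omega⟩, by ext; simp; omega⟩⟩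

/-- The partition `{a}, {b}, S 0, …, S (k - 1)` of the vertices of the reduction graph. -/
def apexPartition {n k : ℕ} (S : Fin k → Finset (Fin n)) : Fin (k + 2) → Finset (Vtx n) :=
  Fin.cons {Sum.inl false} (Fin.cons {Sum.inl true} fun j => (S j).map Function.Embedding.inr)

lemma shortTermCost_apexPartition {n k : ℕ} (x y : Fin n → ℝ) (D : ℝ)
    (S : Fin k → Finset (Fin n)) :
    shortTermCost (apexA x y D) (apexPartition S) = kmeansCost x y S := by
  simp [shortTermCost, kmeansCost, apexPartition, Fin.sum_univ_succ, Wgt, apexA, sum_add_distrib]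

lemma shortTermCost_comp_perm {V : Type*} [Fintype V] [DecidableEq V] {r : ℕ}
    (A : Matrix V V ℝ) (C : Fin r → Finset V) (σ : Equiv.Perm (Fin r)) :
    shortTermCost A (C ∘ σ) = shortTermCost A C := by
  unfold shortTermCost
  refine Eq.trans (sum_congr rfl fun i _ => ?_) (Equiv.sum_comp σ _)
  exact Equiv.sum_comp σ fun j =>
    ∑ v ∈ C (σ i), (Wgt A {v} (C j) - Wgt A (C (σ i)) (C j) / ((C (σ i)).card : ℝ)) ^ 2

/-- Two vertices of one class contribute at least half the squared difference of their
weights into that class. -/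
lemma sq_sub_div_two_le_shortTermCost {V : Type*} [Fintype V] [DecidableEq V] {r : ℕ}
    (A : Matrix V V ℝ) (C : Fin r → Finset V) (i : Fin r) {u v : V}
    (hu : u ∈ C i) (hv : v ∈ C i) (huv : u ≠ v) :
    (Wgt A {u} (C i) - Wgt A {v} (C i)) ^ 2 / 2 ≤ shortTermCost A C := by
  refine (sq_sub_div_two_le_sum_sq_sub (C i) (fun w => Wgt A {w} (C i))
    (Wgt A (C i) (C i) / ((C i).card : ℝ)) hu hv huv).trans ?_
  refine le_trans ?_ (single_le_sum
    (f := fun i => ∑ j, ∑ v ∈ C i, (Wgt A {v} (C j) - Wgt A (C i) (C j) / ((C i).card : ℝ)) ^ 2)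
    (fun _ _ => sum_nonneg fun _ _ => sum_nonneg fun _ _ => sq_nonneg _) (mem_univ i))
  exact single_le_sum
    (f := fun j => ∑ v ∈ C i, (Wgt A {v} (C j) - Wgt A (C i) (C j) / ((C i).card : ℝ)) ^ 2)
    (fun _ _ => sum_nonneg fun _ _ => sq_nonneg _) (mem_univ i)

section ApexBounds

variable {n : ℕ} {x y : Fin n → ℝ} {D : ℝ} {X : Finset (Vtx n)}

lemma Wgt_point_le (hx : ∀ i, 0 ≤ x i) (hy : ∀ i, 0 ≤ y i) (i : Fin n) (X : Finset (Vtx n)) :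
    Wgt (apexA x y D) {Sum.inr i} X ≤ x i + y i := by
  have h : ∑ w ∈ X, apexA x y D (Sum.inr i) w ≤ ∑ w, apexA x y D (Sum.inr i) w := by
    refine sum_le_sum_of_subset_of_nonneg (subset_univ _) fun w _ _ => ?_
    rcases w with (_ | _) | w <;> simp [apexA, hx, hy]
  simpa [Wgt, apexA, add_comm] using h

lemma apexA_apex_nonneg (hx : ∀ i, 0 ≤ x i) (hy : ∀ i, 0 ≤ y i) (hD : 0 ≤ D) (t : Bool)
    (w : Vtx n) : 0 ≤ apexA x y D (Sum.inl t) w := by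
  rcases t with _ | _ <;> rcases w with (_ | _) | w <;> simp [apexA, hx, hy, hD]

/-- An apex sharing a class with a point vertex has weight into that class at least its
self-loop plus the edge to that point. -/
lemma le_Wgt_apex (hx : ∀ i, 0 ≤ x i) (hy : ∀ i, 0 ≤ y i) (hD : 0 ≤ D) {t : Bool} {i : Fin n}
    (ht : Sum.inl t ∈ X) (hi : Sum.inr i ∈ X) :
    apexA x y D (Sum.inl t) (Sum.inl t) + apexA x y D (Sum.inl t) (Sum.inr i) ≤
      Wgt (apexA x y D) {Sum.inl t} X := by
  have h : ∑ w ∈ ({Sum.inl t, Sum.inr i} : Finset (Vtx n)), apexA x y D (Sum.inl t) w ≤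
      ∑ w ∈ X, apexA x y D (Sum.inl t) w :=
    sum_le_sum_of_subset_of_nonneg (by grind) fun w _ _ => apexA_apex_nonneg hx hy hD t w
  rw [sum_pair (by simp)] at h
  simpa [Wgt] using h

lemma le_of_le_sub_of_sq_div_two_le {D d s : ℝ} (hD : 1 ≤ D) (hd : 2 * D ≤ d)
    (hs : d ^ 2 / 2 ≤ s) : D ≤ s := by
  nlinarith

/-- If some class contains an apex and another vertex, the short-term cost is at least `D`. -/
lemma le_shortTermCost_of_apex_mem {r : ℕ} (hx : ∀ i, 0 ≤ x i) (hy : ∀ i, 0 ≤ y i)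
    (hD : D = 1 + ∑ i, (x i ^ 2 + y i ^ 2)) (C : Fin r → Finset (Vtx n)) {j : Fin r} {t : Bool}
    {v : Vtx n} (ht : Sum.inl t ∈ C j) (hv : v ∈ C j) (hvt : v ≠ Sum.inl t) :
    D ≤ shortTermCost (apexA x y D) C := by
  have hD1 : 1 ≤ D := by
    rw [hD]
    have : 0 ≤ ∑ i, (x i ^ 2 + y i ^ 2) := by positivity
    linarith
  by_cases hpt : ∃ i, Sum.inr i ∈ C j
  · obtain ⟨i, hi⟩ := hpt
    have hle : x i ^ 2 + y i ^ 2 ≤ ∑ i, (x i ^ 2 + y i ^ 2) :=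
      single_le_sum (f := fun i => x i ^ 2 + y i ^ 2) (fun _ _ => by positivity) (mem_univ i)
    have hxD : x i ≤ D := by nlinarith [sq_nonneg (x i - 1), sq_nonneg (y i)]
    have hyD : y i ≤ D := by nlinarith [sq_nonneg (y i - 1), sq_nonneg (x i)]
    refine le_of_le_sub_of_sq_div_two_le hD1 ?_
      (sq_sub_div_two_le_shortTermCost _ C j ht hi (by simp))
    have h₁ := le_Wgt_apex hx hy (by linarith) ht hi (D := D)
    have h₂ := Wgt_point_le hx hy i (C j) (D := D)
    rcases t with _ | _ <;> simp only [apexA, of_apply] at h₁ h₂ ⊢ <;> linarith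
  · have hC : C j = {Sum.inl false, Sum.inl true} := by
      ext w
      rcases w with (_ | _) | w <;> rcases v with (_ | _) | v <;> cases t <;> simp_all
    refine le_of_le_sub_of_sq_div_two_le hD1 ?_
      (sq_sub_div_two_le_shortTermCost _ C j (u := Sum.inl true) (v := Sum.inl false)
        (by simp [hC]) (by simp [hC]) (by simp))
    simp [hC, Wgt, apexA]
    linarith

end ApexBounds

lemma exists_perm_fin_zero_one {k : ℕ} {p q : Fin (k + 2)} (hpq : p ≠ q) :
    ∃ σ : Equiv.Perm (Fin (k + 2)), σ 0 = p ∧ σ 1 = q := by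
  refine ⟨Equiv.swap (Equiv.swap 0 p 1) q * Equiv.swap 0 p, ?_, by simp⟩
  have h : p ≠ Equiv.swap 0 p 1 := fun h => by
    have := congrArg (Equiv.swap 0 p) h
    simp at this
  simp [Equiv.swap_apply_of_ne_of_ne h hpq]

/-- A partition in which both apexes are singletons is, up to relabelling, an `apexPartition`. -/
lemma exists_comp_perm_eq_apexPartition {n k : ℕ} (C : Fin (k + 2) → Finset (Vtx n))
    (hdis : ∀ j j', j ≠ j' → Disjoint (C j) (C j')) {p q : Fin (k + 2)}
    (hp : C p = {Sum.inl false}) (hq : C q = {Sum.inl true}) :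
    ∃ (σ : Equiv.Perm (Fin (k + 2))) (S : Fin k → Finset (Fin n)), C ∘ σ = apexPartition S := by
  have hpq : p ≠ q := by rintro rfl; simp [hp] at hq
  obtain ⟨σ, h0, h1⟩ := exists_perm_fin_zero_one hpq
  refine ⟨σ, fun j => (C (σ j.succ.succ)).preimage Sum.inr Sum.inr_injective.injOn, ?_⟩
  funext j
  refine Fin.cases ?_ (fun j => Fin.cases ?_ (fun j => ?_) j) j
  · simp [apexPartition, h0, hp]
  · simp [apexPartition, h1, hq]
  · have hj0 := hdis p (σ j.succ.succ) (h0 ▸ σ.injective.ne (by simp [Fin.ext_iff]))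
    have hj1 := hdis q (σ j.succ.succ) (h1 ▸ σ.injective.ne (by simp [Fin.ext_iff]))
    rw [hp, disjoint_singleton_left] at hj0
    rw [hq, disjoint_singleton_left] at hj1
    ext w
    rcases w with (_ | _) | w <;> simp [apexPartition, hj0, hj1]

/-- Correctness of the reduction from planar k-means: for nonnegative
planar points `(x i, y i)`, `1 ≤ k ≤ n`, a threshold `c`, and `D = 1 + ∑ᵢ (xᵢ² + yᵢ²)`,
there is a partition of the `n` points into `k` nonempty clusters of k-means cost at most `c`
iff there is a partition of the vertices of the reduction graph into `k + 2` nonempty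
classes of short-term cost at most `c`. -/
theorem kmeans_le_iff_shortTermCost_le {n k : ℕ} (hk : 1 ≤ k) (hkn : k ≤ n)
    (x y : Fin n → ℝ) (hx : ∀ i, 0 ≤ x i) (hy : ∀ i, 0 ≤ y i)
    (c : ℝ) (D : ℝ) (hD : D = 1 + ∑ i, (x i ^ 2 + y i ^ 2)) :
    (∃ S' : Fin k → Finset (Fin n),
        (∀ j, (S' j).Nonempty) ∧
        (∀ j j', j ≠ j' → Disjoint (S' j) (S' j')) ∧
        (∀ i : Fin n, ∃ j, i ∈ S' j) ∧
        kmeansCost x y S' ≤ c) ↔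
      (∃ C : Fin (k + 2) → Finset (Vtx n),
        (∀ j, (C j).Nonempty) ∧
        (∀ j j', j ≠ j' → Disjoint (C j) (C j')) ∧
        (∀ v : Vtx n, ∃ j, v ∈ C j) ∧
        shortTermCost (apexA x y D) C ≤ c) := by
  constructor
  · rintro ⟨S, hne, hdis, hcov, hcost⟩
    refine ⟨apexPartition S, ?_, ?_, ?_, (shortTermCost_apexPartition x y D S).trans_le hcost⟩
    · refine Fin.cases ?_ (Fin.cases ?_ fun j => ?_) <;> simp [apexPartition, hne]
    · refine Fin.cases (Fin.cases ?_ (Fin.cases ?_ fun j' => ?_))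
        (Fin.cases (Fin.cases ?_ (Fin.cases ?_ fun j' => ?_))
          fun j => Fin.cases ?_ (Fin.cases ?_ fun j' => ?_)) <;>
        simp [apexPartition]
      exact hdis j j'
    · rintro ((_ | _) | i)
      · exact ⟨0, by simp [apexPartition]⟩
      · exact ⟨Fin.succ 0, by simp only [apexPartition, Fin.cons_succ, Fin.cons_zero, mem_singleton]⟩
      · obtain ⟨j, hj⟩ := hcov i
        exact ⟨j.succ.succ, by simpa [apexPartition] using hj⟩
  · rintro ⟨C, hne, hdis, hcov, hcost⟩
    by_cases hDc : D ≤ c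
    · obtain ⟨f, hf⟩ := exists_surjective_fin hk hkn
      refine ⟨fun j => univ.filter fun i => f i = j, fun j => ?_, fun j j' hjj => ?_,
        fun i => ⟨f i, by simp⟩, (kmeansCost_fibers_le x y f).trans (by linarith)⟩
      · obtain ⟨i, hi⟩ := hf j
        exact ⟨i, by simpa using hi⟩
      · rw [disjoint_filter]
        rintro i - rfl
        exact hjj
    · have hsingle (t : Bool) : ∃ j, C j = {Sum.inl t} := by
        obtain ⟨j, hj⟩ := hcov (Sum.inl t)
        refine ⟨j, eq_singleton_iff_unique_mem.2 ⟨hj, fun v hv => ?_⟩⟩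
        by_contra hvt
        exact hDc ((le_shortTermCost_of_apex_mem hx hy hD C hj hv hvt).trans hcost)
      obtain ⟨p, hp⟩ := hsingle false
      obtain ⟨q, hq⟩ := hsingle true
      obtain ⟨σ, S, hS⟩ := exists_comp_perm_eq_apexPartition C hdis hp hq
      have hCS (j : Fin k) : C (σ j.succ.succ) = (S j).map Function.Embedding.inr := by
        simpa [apexPartition] using congrFun hS j.succ.succ
      refine ⟨S, fun j => ?_, fun j j' hjj => ?_, fun i => ?_, ?_⟩
      · simpa [hCS] using hne (σ j.succ.succ)
      · simpa [hCS] using hdis (σ j.succ.succ) (σ j'.succ.succ) (by simpa using hjj)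
      · obtain ⟨j, hj⟩ := hcov (Sum.inr i)
        obtain ⟨j, rfl⟩ := σ.surjective j
        rw [← Function.comp_apply (f := C), hS] at hj
        revert hj
        refine Fin.cases ?_ (Fin.cases ?_ fun j => ?_) j <;> simp [apexPartition]
        exact fun h => ⟨j, h⟩
      · rwa [← shortTermCost_apexPartition x y D, ← hS, shortTermCost_comp_perm]
end
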